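/- Let C = cone({v_1,…,v_m}) ⊆ ℝ^d be a rational polyhedral pointed cone with m ≥ 1 primitive minimal generators, let w ∈ ℤ^d be primitive with either ⟨w,v_i⟩ > 0 for all i or ⟨w,v_i⟩ < 0 for all i, let F ⊆ w^⊥ be a lattice polytope, and let {G_h}_{h≤0} be a family of possibly-empty rational polytopes with G_0 = {0} and {v_1,…,v_m} ∩ H_{w,h} ⊆ G_h + (−h)F ⊆ C_{w,h} for all real h ≤ 0. Define mut_w(C,F;{G_h}) := cone(⋃_{h≤0} G_h ∪ ⋃_{h≥0} (C_{w,h} + hF)). Then mut_w(C,F;{G_h}) is again a rational polyhedral pointed cone; moreover, if ⟨w,v_i⟩ > 0 for all i, then mut_w(C,F;{G_h}) = cone(C_{w,1} + F). -/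

import Mathlib

open Set Pointwise

/-- The standard pairing `⟨v,u⟩ = ∑ i, v i * u i` on `ι → ℝ`. -/
noncomputable def dotProd {ι : Type*} [Fintype ι] (v u : ι → ℝ) : ℝ := ∑ i, v i * u i

/-- The hyperplane `H_{v,h} = {u : ⟨v,u⟩ = h}`. -/
def hyperplane {ι : Type*} [Fintype ι] (v : ι → ℝ) (h : ℝ) : Set (ι → ℝ) :=
  {u | dotProd v u = h}

/-- The halfspace `H_{v,≥k} = {u : ⟨v,u⟩ ≥ k}`. -/
def halfspaceGe {ι : Type*} [Fintype ι] (v : ι → ℝ) (k : ℝ) : Set (ι → ℝ) :=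
  {u | k ≤ dotProd v u}

/-- The polar dual `P* = {v : ⟨v,u⟩ ≥ -1 for all u ∈ P}`. -/
def polarDual {ι : Type*} [Fintype ι] (P : Set (ι → ℝ)) : Set (ι → ℝ) :=
  {v | ∀ u ∈ P, -1 ≤ dotProd v u}

/-- Cast an integer vector to a real vector. -/
def castZ {ι : Type*} (w : ι → ℤ) : ι → ℝ := fun i => (w i : ℝ)

/-- A nonzero integer vector is primitive if the gcd of its coordinates is 1. -/
def IsPrimitiveVec {ι : Type*} [Fintype ι] (w : ι → ℤ) : Prop :=
  Finset.gcd Finset.univ w = 1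

/-- The set of lattice points of `ι → ℝ`. -/
def latticePts (ι : Type*) : Set (ι → ℝ) := Set.range castZ

/-- A lattice polytope: convex hull of a finite nonempty set of lattice points. -/
def IsLatticePolytope {ι : Type*} [Fintype ι] (P : Set (ι → ℝ)) : Prop :=
  ∃ S : Finset (ι → ℤ), S.Nonempty ∧ P = convexHull ℝ (castZ '' (S : Set (ι → ℤ)))

/-- A rational polytope: some positive integer dilate is a lattice polytope. -/
def IsRationalPolytope {ι : Type*} [Fintype ι] (P : Set (ι → ℝ)) : Prop :=
  ∃ n : ℕ, 0 < n ∧ IsLatticePolytope ((n : ℝ) • P)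

/-- The cone of all nonnegative linear combinations of a finite family of vectors. -/
def coneOf {ι : Type*} [Fintype ι] {κ : Type*} [Fintype κ] (v : κ → ι → ℝ) :
    Set (ι → ℝ) :=
  {x | ∃ c : κ → ℝ, (∀ i, 0 ≤ c i) ∧ x = ∑ i, c i • v i}

/-- The cone of all nonnegative linear combinations of elements of a set. -/
def coneHull {ι : Type*} [Fintype ι] (S : Set (ι → ℝ)) : Set (ι → ℝ) :=
  {x | ∃ (n : ℕ) (c : Fin n → ℝ) (u : Fin n → ι → ℝ),
    (∀ i, 0 ≤ c i) ∧ (∀ i, u i ∈ S) ∧ x = ∑ i, c i • u i}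

/-- `v` is a minimal generating set for the cone it generates. -/
def IsMinimalGen {ι : Type*} [Fintype ι] {κ : Type*} [Fintype κ] [DecidableEq κ]
    (v : κ → ι → ℝ) : Prop :=
  ∀ i : κ, v i ∉ coneOf (fun j : {j : κ // j ≠ i} => v j.1)

/-- The mutation condition for `(P,w,F)` with the family `{G_h}_{h ≤ 0}`:
`V(P) ∩ H_{w,h} ⊆ G_h + (−h)F ⊆ P ∩ H_{w,h}` for all `h ≤ 0`. -/
def MutCond {ι : Type*} [Fintype ι] (P : Set (ι → ℝ)) (w : ι → ℝ) (F : Set (ι → ℝ))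
    (G : ℝ → Set (ι → ℝ)) : Prop :=
  ∀ h : ℝ, h ≤ 0 →
    (P.extremePoints ℝ) ∩ hyperplane w h ⊆ G h + (-h) • F ∧
    G h + (-h) • F ⊆ P ∩ hyperplane w h

/-- The combinatorial mutation `mut_w(P,F;{G_h})` of a rational polytope. -/
def mutPoly {ι : Type*} [Fintype ι] (w : ι → ℝ) (F : Set (ι → ℝ)) (P : Set (ι → ℝ))
    (G : ℝ → Set (ι → ℝ)) : Set (ι → ℝ) :=
  convexHull ℝ ((⋃ h ∈ Set.Iic (0 : ℝ), G h) ∪ ⋃ h ∈ Set.Ici (0 : ℝ), (P ∩ hyperplane w h + h • F))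

/-- The combinatorial mutation `mut_w(C,F;{G_h})` of a cone. -/
def mutCone {ι : Type*} [Fintype ι] (w : ι → ℝ) (F : Set (ι → ℝ)) (C : Set (ι → ℝ))
    (G : ℝ → Set (ι → ℝ)) : Set (ι → ℝ) :=
  coneHull ((⋃ h ∈ Set.Iic (0 : ℝ), G h) ∪ ⋃ h ∈ Set.Ici (0 : ℝ), (C ∩ hyperplane w h + h • F))

/-- `C` is a rational polyhedral pointed cone: generated by finitely many primitive lattice
points forming a minimal generating set, and containing no line. -/
def IsRatPointedCone {ι : Type*} [Fintype ι] (C : Set (ι → ℝ)) : Prop :=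
  ∃ (m : ℕ) (v : Fin m → ι → ℤ),
    (∀ i, IsPrimitiveVec (v i)) ∧
    IsMinimalGen (fun i => castZ (v i)) ∧
    C = coneOf (fun i => castZ (v i)) ∧
    C ∩ (-C) = {0}

/-- The piecewise-linear map `φ_{w,F}(u) = u − u_min · w`, `u_min = min{⟨u,v⟩ : v ∈ F}`. -/
noncomputable def phiMut {ι : Type*} [Fintype ι] (w : ι → ℝ) (F : Set (ι → ℝ))
    (u : ι → ℝ) : ι → ℝ :=
  u - sInf ((fun v => dotProd u v) '' F) • w

/-- The recession cone of a set. -/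
def recessionCone {ι : Type*} [Fintype ι] (A : Set (ι → ℝ)) : Set (ι → ℝ) :=
  {y | ∀ x ∈ A, ∀ t : ℝ, 0 ≤ t → x + t • y ∈ A}

/-- Closed under zero, addition, nonnegative scaling. -/
def ConeLike {ι : Type*} (K : Set (ι → ℝ)) : Prop :=
  0 ∈ K ∧ (∀ x ∈ K, ∀ y ∈ K, x + y ∈ K) ∧ ∀ r : ℝ, 0 ≤ r → ∀ x ∈ K, r • x ∈ K

lemma ConeLike.sum_mem {ι κ : Type*} {K : Set (ι → ℝ)} (hK : ConeLike K) (s : Finset κ)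
    (f : κ → ι → ℝ) (hf : ∀ i ∈ s, f i ∈ K) : ∑ i ∈ s, f i ∈ K := by
  classical
  induction s using Finset.induction_on with
  | empty => simpa using hK.1
  | insert a s ha ih =>
    rw [Finset.sum_insert ha]
    exact hK.2.1 _ (hf a (by simp)) _ (ih fun i hi => hf i (by simp [hi]))

lemma ConeLike.convex {ι : Type*} {K : Set (ι → ℝ)} (hK : ConeLike K) : Convex ℝ K := by
  intro x hx y hy a b ha hb _
  exact hK.2.1 _ (hK.2.2 a ha x hx) _ (hK.2.2 b hb y hy)

lemma coneLike_coneHull {ι : Type*} [Fintype ι] (S : Set (ι → ℝ)) : ConeLike (coneHull S) := by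
  refine ⟨⟨0, fun _ => 0, fun _ => 0, fun i => i.elim0, fun i => i.elim0, by simp⟩, ?_, ?_⟩
  · rintro x ⟨n, c, u, hc, hu, rfl⟩ y ⟨n', c', u', hc', hu', rfl⟩
    refine ⟨n + n', Fin.append c c', Fin.append u u', ?_, ?_, ?_⟩
    · intro i
      refine Fin.addCases (fun j => ?_) (fun j => ?_) i
      · simpa using hc j
      · simpa using hc' j
    · intro i
      refine Fin.addCases (fun j => ?_) (fun j => ?_) i
      · simpa using hu j
      · simpa using hu' j
    · simp [Fin.sum_univ_add]
  · rintro r hr x ⟨n, c, u, hc, hu, rfl⟩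
    exact ⟨n, fun i => r * c i, u, fun i => mul_nonneg hr (hc i), hu, by
      simp [Finset.smul_sum, smul_smul]⟩

lemma subset_coneHull' {ι : Type*} [Fintype ι] (S : Set (ι → ℝ)) : S ⊆ coneHull S := by
  intro x hx
  exact ⟨1, fun _ => 1, fun _ => x, fun _ => zero_le_one, fun _ => hx, by simp⟩

lemma coneHull_min' {ι : Type*} [Fintype ι] {S K : Set (ι → ℝ)} (hK : ConeLike K) (h : S ⊆ K) :
    coneHull S ⊆ K := by
  rintro x ⟨n, c, u, hc, hu, rfl⟩
  exact hK.sum_mem _ _ fun i _ => hK.2.2 _ (hc i) _ (h (hu i))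

lemma coneOf_eq_coneHull {ι κ : Type*} [Fintype ι] [Fintype κ] (v : κ → ι → ℝ) :
    coneOf v = coneHull (Set.range v) := by
  classical
  apply Set.Subset.antisymm
  · rintro x ⟨c, hc, rfl⟩
    exact (coneLike_coneHull _).sum_mem _ _ fun i _ =>
      (coneLike_coneHull _).2.2 _ (hc i) _ (subset_coneHull' _ ⟨i, rfl⟩)
  · apply coneHull_min'
    · refine ⟨⟨fun _ => 0, fun _ => le_rfl, by simp⟩, ?_, ?_⟩
      · rintro x ⟨c, hc, rfl⟩ y ⟨c', hc', rfl⟩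
        exact ⟨fun i => c i + c' i, fun i => add_nonneg (hc i) (hc' i), by
          simp [add_smul, Finset.sum_add_distrib]⟩
      · rintro r hr x ⟨c, hc, rfl⟩
        exact ⟨fun i => r * c i, fun i => mul_nonneg hr (hc i), by
          simp [Finset.smul_sum, smul_smul]⟩
    · rintro _ ⟨i, rfl⟩
      refine ⟨fun j => if j = i then 1 else 0, fun j => by dsimp only; split_ifs <;> norm_num, ?_⟩
      simp [ite_smul]

lemma dotProd_add {ι : Type*} [Fintype ι] (w x y : ι → ℝ) :
    dotProd w (x + y) = dotProd w x + dotProd w y := by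
  simp [dotProd, mul_add, Finset.sum_add_distrib]

lemma dotProd_smul {ι : Type*} [Fintype ι] (w : ι → ℝ) (r : ℝ) (x : ι → ℝ) :
    dotProd w (r • x) = r * dotProd w x := by
  simp only [dotProd, Pi.smul_apply, smul_eq_mul, Finset.mul_sum]
  exact Finset.sum_congr rfl fun i _ => by ring

lemma dotProd_zero {ι : Type*} [Fintype ι] (w : ι → ℝ) : dotProd w 0 = 0 := by simp [dotProd]

lemma dotProd_neg_left {ι : Type*} [Fintype ι] (w x : ι → ℝ) :
    dotProd (-w) x = - dotProd w x := by simp [dotProd]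

lemma dotProd_neg {ι : Type*} [Fintype ι] (w x : ι → ℝ) :
    dotProd w (-x) = - dotProd w x := by simp [dotProd]

lemma dotProd_sum {ι κ : Type*} [Fintype ι] (w : ι → ℝ) (s : Finset κ) (f : κ → ι → ℝ) :
    dotProd w (∑ i ∈ s, f i) = ∑ i ∈ s, dotProd w (f i) := by
  classical
  induction s using Finset.induction_on with
  | empty => simp [dotProd_zero]
  | insert a s ha ih => rw [Finset.sum_insert ha, Finset.sum_insert ha, dotProd_add, ih]

lemma pos_or_zero {ι : Type*} [Fintype ι] (w : ι → ℝ) {S : Set (ι → ℝ)}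
    (hS : ∀ s ∈ S, 0 < dotProd w s) {x : ι → ℝ} (hx : x ∈ coneHull S) :
    x = 0 ∨ 0 < dotProd w x := by
  have : coneHull S ⊆ {x | x = 0 ∨ 0 < dotProd w x} := by
    apply coneHull_min'
    · refine ⟨Or.inl rfl, ?_, ?_⟩
      · rintro x (rfl | hx) y (rfl | hy)
        · simp
        · simp [hy]
        · simp [hx]
        · right; rw [dotProd_add]; positivity
      · rintro r hr x (rfl | hx)
        · simp
        · rcases hr.eq_or_lt with rfl | hr
          · simp
          · right; rw [dotProd_smul]; positivity
    · exact fun s hs => Or.inr (hS s hs)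
  exact this hx

lemma exists_prim {ι : Type*} [Fintype ι] (t : ι → ℤ) (ht : t ≠ 0) :
    ∃ p : ι → ℤ, IsPrimitiveVec p ∧ ∃ r : ℝ, 0 < r ∧ castZ t = r • castZ p := by
  obtain ⟨i₀, hi₀⟩ : ∃ i, t i ≠ 0 := by
    by_contra! h; exact ht (funext h)
  obtain ⟨p, hp, hg⟩ := Finset.extract_gcd t (s := Finset.univ) ⟨i₀, Finset.mem_univ _⟩
  refine ⟨p, hg, ((Finset.univ.gcd t : ℤ) : ℝ), ?_, ?_⟩
  · have h0 : 0 ≤ Finset.univ.gcd t := by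
      rw [← Finset.normalize_gcd]
      exact Int.nonneg_of_normalize_eq_self (by simp)
    have h1 : Finset.univ.gcd t ≠ 0 := by
      intro h; exact hi₀ (Finset.gcd_eq_zero_iff.1 h i₀ (Finset.mem_univ _))
    exact_mod_cast lt_of_le_of_ne h0 h1.symm
  · ext i
    simp only [castZ, Pi.smul_apply, smul_eq_mul]
    exact_mod_cast hp i (Finset.mem_univ _)

lemma ratPointed_of_finset {ι : Type*} [Fintype ι] (w : ι → ℝ) (T : Finset (ι → ℤ))
    (hT : ∀ t ∈ T, 0 < dotProd w (castZ t)) :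
    IsRatPointedCone (coneHull (castZ '' (T : Set (ι → ℤ)))) := by
  classical
  set K := coneHull (castZ '' (T : Set (ι → ℤ))) with hK
  have hKc : ConeLike K := coneLike_coneHull _
  have ex : ∃ n : ℕ, ∃ U : Finset (ι → ℤ), (∀ p ∈ U, IsPrimitiveVec p) ∧
      coneHull (castZ '' (U : Set (ι → ℤ))) = K ∧ U.card = n := by
    have : ∀ t : T, ∃ p : ι → ℤ, IsPrimitiveVec p ∧ ∃ r : ℝ, 0 < r ∧ castZ t.1 = r • castZ p := by
      rintro ⟨t, ht⟩
      apply exists_prim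
      rintro rfl
      have := hT _ ht
      simp [dotProd, castZ] at this
    choose p hp r hr hpr using this
    refine ⟨_, Finset.univ.image p, ?_, ?_, rfl⟩
    · simp only [Finset.mem_image]
      rintro _ ⟨t, _, rfl⟩; exact hp t
    · apply Set.Subset.antisymm
      · apply coneHull_min' hKc
        rintro _ ⟨q, hq, rfl⟩
        simp only [Finset.coe_image, Finset.coe_univ, Set.image_univ, Set.mem_range] at hq
        obtain ⟨t, rfl⟩ := hq
        have : castZ (p t) = (r t)⁻¹ • castZ t.1 := by
          rw [hpr, smul_smul, inv_mul_cancel₀ (hr t).ne', one_smul]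
        rw [this]
        exact hKc.2.2 _ (inv_nonneg.2 (hr t).le) _ (subset_coneHull' _ ⟨t.1, t.2, rfl⟩)
      · apply coneHull_min' (coneLike_coneHull _)
        rintro _ ⟨t, ht, rfl⟩
        have h := hpr ⟨t, ht⟩
        rw [h]
        exact (coneLike_coneHull _).2.2 _ (hr _).le _ (subset_coneHull' _ ⟨_, by simp, rfl⟩)
  obtain ⟨U, hUp, hUK, hUc⟩ := Nat.find_spec ex
  have hUmin := fun n hn => Nat.find_min ex (m := n) hn
  rw [← hUc] at hUmin
  let e := U.equivFin.symm
  have hr : Set.range (fun i => castZ (e i).1) = castZ '' (U : Set (ι → ℤ)) := by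
    ext x; constructor
    · rintro ⟨i, rfl⟩; exact ⟨_, (e i).2, rfl⟩
    · rintro ⟨u, hu, rfl⟩; exact ⟨e.symm ⟨u, hu⟩, by simp⟩
  refine ⟨U.card, fun i => (e i).1, fun i => hUp _ (e i).2, ?_, ?_, ?_⟩
  · intro i hi
    rw [coneOf_eq_coneHull] at hi
    refine hUmin (U.erase (e i).1).card (Finset.card_erase_lt_of_mem (e i).2)
      ⟨U.erase (e i).1, fun p hp => hUp p (Finset.mem_of_mem_erase hp), ?_, rfl⟩
    have hsub : coneHull (Set.range fun j : {j // j ≠ i} => castZ (e j.1).1) ⊆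
        coneHull (castZ '' ((U.erase (e i).1 : Finset (ι → ℤ)) : Set (ι → ℤ))) := by
      apply coneHull_min' (coneLike_coneHull _)
      rintro _ ⟨⟨j, hj⟩, rfl⟩
      apply subset_coneHull'
      refine ⟨_, ?_, rfl⟩
      simp only [Finset.coe_erase, Set.mem_sdiff, Finset.mem_coe, (e j).2, true_and,
        Set.mem_singleton_iff]
      intro h
      exact hj (e.injective (Subtype.ext h))
    apply Set.Subset.antisymm
    · rw [← hUK]
      apply coneHull_min' (coneLike_coneHull _)
      refine (Set.image_mono ?_).trans (subset_coneHull' _)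
      simp
    · rw [← hUK]
      apply coneHull_min' (coneLike_coneHull _)
      rintro _ ⟨u, hu, rfl⟩
      by_cases h : u = (e i).1
      · rw [h]; exact hsub hi
      · exact subset_coneHull' _ ⟨u, by simp [h]; exact hu, rfl⟩
  · rw [coneOf_eq_coneHull, hr, hUK]
  · apply Set.Subset.antisymm
    · rintro x ⟨hx, hx'⟩
      have hS : ∀ s ∈ castZ '' (T : Set (ι → ℤ)), 0 < dotProd w s := by
        rintro _ ⟨t, ht, rfl⟩; exact hT t ht
      rcases pos_or_zero w hS hx with h | h
      · exact h
      · rcases pos_or_zero w hS hx' with h' | h'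
        · simpa using h'
        · rw [dotProd_neg] at h'; linarith
    · rintro _ rfl
      exact ⟨hKc.1, by simpa using hKc.1⟩

/-- Integer pairing. -/
def dotInt {ι : Type*} [Fintype ι] (w u : ι → ℤ) : ℤ := ∑ i, w i * u i

lemma dotInt_cast {ι : Type*} [Fintype ι] (w u : ι → ℤ) :
    ((dotInt w u : ℤ) : ℝ) = dotProd (castZ w) (castZ u) := by
  simp [dotInt, dotProd, castZ]

lemma pos_case {d m : ℕ} (v : Fin m → Fin d → ℤ)
    (C : Set (Fin d → ℝ)) (hC : C = coneOf (fun i => castZ (v i)))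
    (w : Fin d → ℤ)
    (hsign : ∀ i, 0 < dotProd (castZ w) (castZ (v i)))
    (F : Set (Fin d → ℝ)) (hF : IsLatticePolytope F) (hFw : F ⊆ hyperplane (castZ w) 0)
    (G : ℝ → Set (Fin d → ℝ))
    (hG0 : G 0 = {0})
    (hGcond : ∀ h : ℝ, h ≤ 0 → G h + (-h) • F ⊆ C ∩ hyperplane (castZ w) h) :
    IsRatPointedCone (mutCone (castZ w) F C G) ∧
      mutCone (castZ w) F C G = coneHull (C ∩ hyperplane (castZ w) 1 + F) := by
  classical
  obtain ⟨S, hSne, hFS⟩ := hF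
  have hSF : ∀ s ∈ S, castZ s ∈ F := fun s hs => by
    rw [hFS]; exact subset_convexHull _ _ ⟨s, hs, rfl⟩
  have hCc : ConeLike C := by rw [hC, coneOf_eq_coneHull]; exact coneLike_coneHull _
  have hvC : ∀ i, castZ (v i) ∈ C := fun i => by
    rw [hC, coneOf_eq_coneHull]; exact subset_coneHull' _ ⟨i, rfl⟩
  let T : Finset (Fin d → ℤ) :=
    (Finset.univ ×ˢ S).image fun p : Fin m × (Fin d → ℤ) => v p.1 + dotInt w (v p.1) • p.2
  have hTc : ∀ i s, castZ (v i + dotInt w (v i) • s) =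
      castZ (v i) + dotProd (castZ w) (castZ (v i)) • castZ s := by
    intro i s
    rw [← dotInt_cast]
    ext j; simp [castZ]
  have h1 : coneHull (castZ '' (T : Set (Fin d → ℤ))) ⊆
      coneHull (C ∩ hyperplane (castZ w) 1 + F) := by
    apply coneHull_min' (coneLike_coneHull _)
    rintro _ ⟨t, ht, rfl⟩
    simp only [T, Finset.coe_image, Set.mem_image, Finset.mem_coe, Finset.mem_product] at ht
    obtain ⟨⟨i, s⟩, ⟨-, hs⟩, rfl⟩ := ht
    simp only at hs ⊢
    have hp := hsign i
    rw [hTc]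
    set h := dotProd (castZ w) (castZ (v i)) with hh
    have : castZ (v i) + h • castZ s = h • (h⁻¹ • castZ (v i) + castZ s) := by
      rw [smul_add, smul_smul, mul_inv_cancel₀ hp.ne', one_smul]
    rw [this]
    refine (coneLike_coneHull _).2.2 _ hp.le _ (subset_coneHull' _ ?_)
    refine Set.add_mem_add ⟨hCc.2.2 _ (inv_nonneg.2 hp.le) _ (hvC i), ?_⟩ (hSF s hs)
    change dotProd _ _ = 1
    rw [dotProd_smul, ← hh, inv_mul_cancel₀ hp.ne']
  have h2 : coneHull (C ∩ hyperplane (castZ w) 1 + F) ⊆ mutCone (castZ w) F C G := by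
    apply coneHull_min' (coneLike_coneHull _)
    intro x hx
    apply subset_coneHull'
    right
    simp only [Set.mem_iUnion]
    exact ⟨1, by simp, by simpa using hx⟩
  have hTK : ∀ i, ∀ f ∈ F, castZ (v i) + dotProd (castZ w) (castZ (v i)) • f ∈
      coneHull (castZ '' (T : Set (Fin d → ℤ))) := by
    intro i
    set h := dotProd (castZ w) (castZ (v i)) with hh
    have : F ⊆ {f | castZ (v i) + h • f ∈ coneHull (castZ '' (T : Set (Fin d → ℤ)))} := by
      rw [hFS]
      apply convexHull_min
      · rintro _ ⟨s, hs, rfl⟩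
        apply subset_coneHull'
        refine ⟨_, ?_, hTc i s⟩
        simp only [T, Finset.coe_image]
        exact ⟨(i, s), by simpa using hs, rfl⟩
      · intro f hf g hg a b ha hb hab
        have := (coneLike_coneHull (castZ '' (T : Set (Fin d → ℤ)))).convex hf hg ha hb hab
        simp only [Set.mem_setOf_eq]
        convert this using 1
        have hv : castZ (v i) = (a + b) • castZ (v i) := by rw [hab, one_smul]
        nth_rewrite 1 [hv]
        module
    exact this
  have h3 : mutCone (castZ w) F C G ⊆ coneHull (castZ '' (T : Set (Fin d → ℤ))) := by
    apply coneHull_min' (coneLike_coneHull _)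
    rintro x (hx | hx)
    · simp only [Set.mem_iUnion, Set.mem_Iic] at hx
      obtain ⟨h, hh, hx⟩ := hx
      rcases hh.eq_or_lt with rfl | hlt
      · rw [hG0] at hx
        rw [Set.mem_singleton_iff.1 hx]
        exact (coneLike_coneHull _).1
      · obtain ⟨s, hs⟩ := hSne
        obtain ⟨hc, hw⟩ := hGcond h hh (Set.add_mem_add hx (Set.smul_mem_smul_set (hSF s hs)))
        rw [hC] at hc
        obtain ⟨c, hc, hx⟩ := hc
        change dotProd _ _ = h at hw
        rw [hx, dotProd_sum] at hw
        simp only [dotProd_smul] at hw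
        have : 0 ≤ ∑ i, c i * dotProd (castZ w) (castZ (v i)) :=
          Finset.sum_nonneg fun i _ => mul_nonneg (hc i) (hsign i).le
        linarith
    · simp only [Set.mem_iUnion, Set.mem_Ici] at hx
      obtain ⟨h, hh, x, ⟨hxC, hxw⟩, y, hy, rfl⟩ := hx
      obtain ⟨f, hf, rfl⟩ := hy
      rw [hC] at hxC
      obtain ⟨c, hc, rfl⟩ := hxC
      change dotProd _ _ = h at hxw
      rw [dotProd_sum] at hxw
      simp only [dotProd_smul] at hxw
      have : (∑ i, c i • castZ (v i)) + h • f =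
          ∑ i, c i • (castZ (v i) + dotProd (castZ w) (castZ (v i)) • f) := by
        simp only [smul_add, Finset.sum_add_distrib, smul_smul]
        rw [← Finset.sum_smul, hxw]
      simp only [this]
      exact (coneLike_coneHull _).sum_mem _ _ fun i _ =>
        (coneLike_coneHull _).2.2 _ (hc i) _ (hTK i f hf)
  have heq : mutCone (castZ w) F C G = coneHull (castZ '' (T : Set (Fin d → ℤ))) :=
    h3.antisymm (h1.trans h2)
  refine ⟨?_, (h3.trans h1).antisymm h2⟩
  rw [heq]
  apply ratPointed_of_finset (castZ w)
  intro t ht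
  simp only [T, Finset.mem_image, Finset.mem_product] at ht
  obtain ⟨⟨i, s⟩, ⟨-, hs⟩, rfl⟩ := ht
  have hs0 : dotProd (castZ w) (castZ s) = 0 := hFw (hSF s hs)
  simp only [hTc, dotProd_add, dotProd_smul, hs0]
  simpa using hsign i

lemma neg_case {d m : ℕ} (v : Fin m → Fin d → ℤ)
    (C : Set (Fin d → ℝ)) (hC : C = coneOf (fun i => castZ (v i)))
    (w : Fin d → ℤ)
    (hsign : ∀ i, dotProd (castZ w) (castZ (v i)) < 0)
    (F : Set (Fin d → ℝ)) (hF : IsLatticePolytope F) (hFw : F ⊆ hyperplane (castZ w) 0)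
    (G : ℝ → Set (Fin d → ℝ))
    (hGrat : ∀ h : ℝ, h ≤ 0 → G h = ∅ ∨ IsRationalPolytope (G h))
    (hG0 : G 0 = {0})
    (hGcond : ∀ h : ℝ, h ≤ 0 →
      Set.range (fun i => castZ (v i)) ∩ hyperplane (castZ w) h ⊆ G h + (-h) • F ∧
      G h + (-h) • F ⊆ C ∩ hyperplane (castZ w) h) :
    IsRatPointedCone (mutCone (castZ w) F C G) := by
  classical
  obtain ⟨S, hSne, hFS⟩ := hF
  have hSF : ∀ s ∈ S, castZ s ∈ F := fun s hs => by
    rw [hFS]; exact subset_convexHull _ _ ⟨s, hs, rfl⟩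
  have hGH : ∀ h ≤ 0, ∀ x ∈ G h, dotProd (castZ w) x = h := by
    intro h hh x hx
    obtain ⟨s, hs⟩ := hSne
    have h1 := ((hGcond h hh).2 (Set.add_mem_add hx (Set.smul_mem_smul_set (hSF s hs)))).2
    change dotProd _ _ = h at h1
    have hs0 : dotProd (castZ w) (castZ s) = 0 := hFw (hSF s hs)
    rw [dotProd_add, dotProd_smul, hs0] at h1
    linarith
  -- decomposition of the generators
  have hdec : ∀ i, ∃ g ∈ G (dotProd (castZ w) (castZ (v i))), ∃ f ∈ F,
      castZ (v i) = g + (-dotProd (castZ w) (castZ (v i))) • f := by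
    intro i
    obtain ⟨g, hg, y, ⟨f, hf, rfl⟩, h⟩ := (hGcond _ (hsign i).le).1 ⟨⟨i, rfl⟩, rfl⟩
    exact ⟨g, hg, f, hf, h.symm⟩
  choose g hg f hf hgf using hdec
  have hrat : ∀ i, ∃ n : ℕ, 0 < n ∧ ∃ U : Finset (Fin d → ℤ),
      (n : ℝ) • G (dotProd (castZ w) (castZ (v i))) =
        convexHull ℝ (castZ '' (U : Set (Fin d → ℤ))) := by
    intro i
    rcases hGrat _ (hsign i).le with h | ⟨n, hn, U, -, hU⟩
    · have := hg i; rw [h] at this; exact this.elim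
    · exact ⟨n, hn, U, hU⟩
  choose n hn U hU using hrat
  have hUG : ∀ i, ∀ u ∈ U i, ∃ x ∈ G (dotProd (castZ w) (castZ (v i))),
      castZ u = (n i : ℝ) • x := by
    intro i u hu
    have : castZ u ∈ (n i : ℝ) • G (dotProd (castZ w) (castZ (v i))) := by
      rw [hU]; exact subset_convexHull _ _ ⟨u, hu, rfl⟩
    obtain ⟨x, hx, h⟩ := this
    exact ⟨x, hx, h.symm⟩
  let T : Finset (Fin d → ℤ) := Finset.univ.biUnion U
  set K := coneHull (castZ '' (T : Set (Fin d → ℤ))) with hKdef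
  have hK : ConeLike K := coneLike_coneHull _
  have hgK : ∀ i, g i ∈ K := by
    intro i
    have h1 : (n i : ℝ) • g i ∈ K := by
      have : (n i : ℝ) • g i ∈ (n i : ℝ) • G (dotProd (castZ w) (castZ (v i))) :=
        Set.smul_mem_smul_set (hg i)
      rw [hU] at this
      refine convexHull_min ?_ hK.convex this
      refine Set.Subset.trans (Set.image_mono ?_) (subset_coneHull' _)
      intro u hu
      simp only [T, Finset.coe_biUnion, Set.mem_iUnion]
      exact ⟨i, by simp, hu⟩
    have hn' : (0 : ℝ) < n i := by exact_mod_cast hn i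
    have : g i = (n i : ℝ)⁻¹ • ((n i : ℝ) • g i) := by
      rw [smul_smul, inv_mul_cancel₀ hn'.ne', one_smul]
    rw [this]
    exact hK.2.2 _ (inv_nonneg.2 hn'.le) _ h1
  have h1 : K ⊆ mutCone (castZ w) F C G := by
    apply coneHull_min' (coneLike_coneHull _)
    rintro _ ⟨u, hu, rfl⟩
    simp only [T, Finset.coe_biUnion, Set.mem_iUnion] at hu
    obtain ⟨i, -, hu⟩ := hu
    obtain ⟨x, hx, h⟩ := hUG i u hu
    rw [h]
    refine (coneLike_coneHull _).2.2 _ (Nat.cast_nonneg _) _ (subset_coneHull' _ (Or.inl ?_))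
    simp only [Set.mem_iUnion]
    exact ⟨_, (hsign i).le, hx⟩
  let g' : Fin m → Fin d → ℝ := fun i => (-dotProd (castZ w) (castZ (v i)))⁻¹ • g i
  have hBK : convexHull ℝ (Set.range g') ⊆ K := by
    apply convexHull_min _ hK.convex
    rintro _ ⟨i, rfl⟩
    exact hK.2.2 _ (inv_nonneg.2 (by linarith [hsign i])) _ (hgK i)
  have hGK : ∀ h < 0, ∀ a ∈ G h, a ∈ K := by
    intro h hh a ha
    have hh' : 0 < -h := by linarith
    have haa : a = (-h) • ((-h)⁻¹ • a) := by
      rw [smul_smul, mul_inv_cancel₀ hh'.ne', one_smul]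
    suffices hs : (-h)⁻¹ • a ∈ convexHull ℝ (Set.range g') by
      rw [haa]; exact hK.2.2 _ hh'.le _ (hBK hs)
    by_contra hnot
    obtain ⟨l, u, hl, hu⟩ := geometric_hahn_banach_closed_point (convex_convexHull ℝ _)
      ((Set.finite_range g').isClosed_convexHull ℝ) hnot
    obtain ⟨s, hs, hsmax⟩ := S.exists_max_image (fun s => l (castZ s)) hSne
    have hFmax : ∀ y ∈ F, l y ≤ l (castZ s) := by
      have : F ⊆ {y | l y ≤ l (castZ s)} := by
        rw [hFS]
        apply convexHull_min
        · rintro _ ⟨t, ht, rfl⟩; exact hsmax t ht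
        · exact convex_halfSpace_le l.toLinearMap.isLinear _
      exact this
    obtain ⟨hc, hw⟩ := (hGcond h hh.le).2
      (Set.add_mem_add ha (Set.smul_mem_smul_set (hSF s hs)))
    rw [hC] at hc
    obtain ⟨c, hc, hx⟩ := hc
    change dotProd _ _ = h at hw
    rw [hx, dotProd_sum] at hw
    simp only [dotProd_smul] at hw
    have hlx := congrArg l hx
    simp only [map_add, map_smul, map_sum, smul_eq_mul] at hlx
    have hterm : ∀ i, c i * l (castZ (v i)) ≤
        (c i * dotProd (castZ w) (castZ (v i))) * (-(u + l (castZ s))) := by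
      intro i
      have e1 : l (castZ (v i)) = l (g i) + -dotProd (castZ w) (castZ (v i)) * l (f i) := by
        conv_lhs => rw [hgf i]
        simp only [map_add, map_smul, smul_eq_mul]
      have e2 : l (g' i) < u := hl _ (subset_convexHull _ _ ⟨i, rfl⟩)
      have e3 : l (g i) = -dotProd (castZ w) (castZ (v i)) * l (g' i) := by
        simp only [g', map_smul, smul_eq_mul]
        rw [mul_inv_cancel_left₀]
        linarith [hsign i]
      have e4 := hFmax _ (hf i)
      have e5 : l (castZ (v i)) ≤ -dotProd (castZ w) (castZ (v i)) * (u + l (castZ s)) := by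
        rw [e1, e3, ← mul_add]
        exact mul_le_mul_of_nonneg_left (by linarith) (by linarith [hsign i])
      calc _ ≤ c i * _ := mul_le_mul_of_nonneg_left e5 (hc i)
        _ = _ := by ring
    have hsum := Finset.sum_le_sum fun i (_ : i ∈ Finset.univ) => hterm i
    rw [← Finset.sum_mul, hw, ← hlx] at hsum
    have hfin : l a ≤ -h * u := by linarith
    have : l ((-h)⁻¹ • a) ≤ u := by
      rw [map_smul, smul_eq_mul, inv_mul_le_iff₀ hh']
      exact hfin
    linarith
  have h2 : mutCone (castZ w) F C G ⊆ K := by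
    apply coneHull_min' hK
    rintro x (hx | hx)
    · simp only [Set.mem_iUnion, Set.mem_Iic] at hx
      obtain ⟨h, hh, hx⟩ := hx
      rcases hh.eq_or_lt with rfl | hlt
      · rw [hG0] at hx
        rw [Set.mem_singleton_iff.1 hx]
        exact hK.1
      · exact hGK h hlt x hx
    · simp only [Set.mem_iUnion, Set.mem_Ici] at hx
      obtain ⟨h, hh, x, ⟨hxC, hxw⟩, y, hy, rfl⟩ := hx
      obtain ⟨y, hy, rfl⟩ := hy
      rw [hC] at hxC
      rw [coneOf_eq_coneHull] at hxC
      change dotProd _ _ = h at hxw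
      have := pos_or_zero (-castZ w) (by
        rintro _ ⟨i, rfl⟩
        rw [dotProd_neg_left]; linarith [hsign i]) hxC
      rcases this with rfl | h0
      · rw [dotProd_zero] at hxw
        subst hxw
        simpa using hK.1
      · rw [dotProd_neg_left] at h0; linarith
  rw [h2.antisymm h1]
  apply ratPointed_of_finset (-castZ w)
  intro t ht
  simp only [T, Finset.mem_biUnion] at ht
  obtain ⟨i, -, ht⟩ := ht
  obtain ⟨x, hx, h⟩ := hUG i t ht
  have hn' : (0 : ℝ) < n i := by exact_mod_cast hn i
  rw [h, dotProd_smul, dotProd_neg_left, hGH _ (hsign i).le x hx]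
  exact mul_pos hn' (by linarith [hsign i])

/-- The combinatorial mutation of a rational polyhedral pointed cone is
again a rational polyhedral pointed cone; moreover if all `⟨w,v_i⟩ > 0` then
`mut_w(C,F) = cone(C_{w,1} + F)`. -/
theorem stmt_8 {d m : ℕ} (hm : 1 ≤ m) (v : Fin m → Fin d → ℤ)
    (hprim : ∀ i, IsPrimitiveVec (v i))
    (hmin : IsMinimalGen (fun i => castZ (v i)))
    (C : Set (Fin d → ℝ)) (hC : C = coneOf (fun i => castZ (v i)))
    (hpointed : C ∩ (-C) = {0})
    (w : Fin d → ℤ) (hw : IsPrimitiveVec w)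
    (hsign : (∀ i, 0 < dotProd (castZ w) (castZ (v i))) ∨
      (∀ i, dotProd (castZ w) (castZ (v i)) < 0))
    (F : Set (Fin d → ℝ)) (hF : IsLatticePolytope F) (hFw : F ⊆ hyperplane (castZ w) 0)
    (G : ℝ → Set (Fin d → ℝ))
    (hGrat : ∀ h : ℝ, h ≤ 0 → G h = ∅ ∨ IsRationalPolytope (G h))
    (hG0 : G 0 = {0})
    (hGcond : ∀ h : ℝ, h ≤ 0 →
      Set.range (fun i => castZ (v i)) ∩ hyperplane (castZ w) h ⊆ G h + (-h) • F ∧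
      G h + (-h) • F ⊆ C ∩ hyperplane (castZ w) h) :
    IsRatPointedCone (mutCone (castZ w) F C G) ∧
    ((∀ i, 0 < dotProd (castZ w) (castZ (v i))) →
      mutCone (castZ w) F C G = coneHull (C ∩ hyperplane (castZ w) 1 + F)) := by
  refine ⟨?_, fun hpos => (pos_case v C hC w hpos F hF hFw G hG0 fun h hh => (hGcond h hh).2).2⟩
  rcases hsign with hpos | hneg
  · exact (pos_case v C hC w hpos F hF hFw G hG0 fun h hh => (hGcond h hh).2).1
  · exact neg_case v C hC w hneg F hF hFw G hGrat hG0 hGcond
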